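/- arXiv:1608.08000 — 2 statements merged into one kernel-verified Lean document; each statement's English description precedes it below -/
import Mathlib

section
/- Let (E, g) be a polymatroid and, for each e ∈ E, let w_e : ℝ_{≥0} → ℝ be strictly convex and continuously differentiable with derivative h_e (so each h_e is continuous and strictly increasing). A base x ∈ B(g) minimizes Σ_{e ∈ E} w_e(y(e)) over all y ∈ B(g) if and only if x is an h-lexicographically optimal base of (E, g), where h(x) := (h_e(x(e)))_{e ∈ E}. -/
/-- A rank function on the finite ground set `Fin n`: nonnegative, zero on `∅`,
nondecreasing and submodular.  `(E, g)` is then a polymatroid. -/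
def IsRankFunction {n : ℕ} (g : Finset (Fin n) → ℝ) : Prop :=
  g ∅ = 0 ∧ (∀ A, 0 ≤ g A) ∧ (∀ A B : Finset (Fin n), A ⊆ B → g A ≤ g B) ∧
    ∀ A B : Finset (Fin n), g (A ∪ B) + g (A ∩ B) ≤ g A + g B

/-- The polymatroidal polyhedron `P(g)` of independent vectors. -/
def polyP {n : ℕ} (g : Finset (Fin n) → ℝ) : Set (Fin n → ℝ) :=
  {x | (∀ e, 0 ≤ x e) ∧ ∀ A : Finset (Fin n), ∑ e ∈ A, x e ≤ g A}

/-- The base `B(g)` of the polymatroid `(E, g)`. -/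
def polyBase {n : ℕ} (g : Finset (Fin n) → ℝ) : Set (Fin n → ℝ) :=
  {x ∈ polyP g | ∑ e, x e = g Finset.univ}

/-- `T(x)`: the components of `x` arranged in nondecreasing order. -/
noncomputable def sortedTuple {n : ℕ} (x : Fin n → ℝ) : Fin n → ℝ :=
  x ∘ Tuple.sort x

/-- `a` is lexicographically greater than or equal to `b`. -/
def LexGE {n : ℕ} (a b : Fin n → ℝ) : Prop :=
  a = b ∨ ∃ j : Fin n, (∀ i < j, a i = b i) ∧ b j < a j

/-- `x` is an `h`-lexicographically optimal base of `(E, g)`: `x ∈ B(g)` and the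
sorted tuple `T(h(x))` is lexicographically maximum among all `T(h(y))`, `y ∈ B(g)`. -/
def IsLexOptimalBase {n : ℕ} (g : Finset (Fin n) → ℝ) (h : Fin n → ℝ → ℝ)
    (x : Fin n → ℝ) : Prop :=
  x ∈ polyBase g ∧ ∀ y ∈ polyBase g,
    LexGE (sortedTuple (fun e => h e (x e))) (sortedTuple (fun e => h e (y e)))

/-- `A` is tight for `x`. -/
def PMTight {n : ℕ} (g : Finset (Fin n) → ℝ) (x : Fin n → ℝ) (A : Finset (Fin n)) : Prop :=
  ∑ e ∈ A, x e = g A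

theorem pm_tight_union_inter {n : ℕ} {g : Finset (Fin n) → ℝ} (hg : IsRankFunction g)
    {x : Fin n → ℝ} (hx : x ∈ polyBase g) {A B : Finset (Fin n)}
    (hA : PMTight g x A) (hB : PMTight g x B) :
    PMTight g x (A ∪ B) ∧ PMTight g x (A ∩ B) := by
  unfold PMTight at *
  have h1 := hx.1.2 (A ∪ B)
  have h2 := hx.1.2 (A ∩ B)
  have h3 := hg.2.2.2 A B
  have h4 := Finset.sum_union_inter (s₁ := A) (s₂ := B) (f := x)
  constructor <;> linarith

/-- A minimizer admits no improving exchange. -/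
theorem pm_exchange {n : ℕ} {g : Finset (Fin n) → ℝ} {w h : Fin n → ℝ → ℝ}
    (hconv : ∀ e, StrictConvexOn ℝ (Set.Ici 0) (w e))
    (hderiv : ∀ e, ∀ t ∈ Set.Ici (0 : ℝ), HasDerivWithinAt (w e) (h e t) (Set.Ici 0) t)
    (hcont : ∀ e, ContinuousOn (h e) (Set.Ici 0))
    {x : Fin n → ℝ} (hx : x ∈ polyBase g)
    (hmin : ∀ y ∈ polyBase g, ∑ e, w e (x e) ≤ ∑ e, w e (y e))
    (e f : Fin n) (hf : 0 < x f) (hlt : h e (x e) < h f (x f)) :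
    ∃ A : Finset (Fin n), e ∈ A ∧ f ∉ A ∧ PMTight g x A := by
  by_contra! hno
  have hef : e ≠ f := by rintro rfl; exact lt_irrefl _ hlt
  have hxe : 0 ≤ x e := hx.1.1 e
  have ev1 : ∀ᶠ ε in nhdsWithin (0 : ℝ) (Set.Ioi 0), ∀ A : Finset (Fin n),
      e ∈ A → f ∉ A → ε ≤ g A - ∑ i ∈ A, x i := by
    rw [Filter.eventually_all]
    intro A
    by_cases hA : e ∈ A ∧ f ∉ A
    · have hlt' : 0 < g A - ∑ i ∈ A, x i := by
        have := lt_of_le_of_ne (hx.1.2 A) (hno A hA.1 hA.2)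
        linarith
      filter_upwards [nhdsWithin_le_nhds (eventually_le_nhds hlt')] with ε hε _ _ using hε
    · exact Filter.Eventually.of_forall fun ε h1 h2 => absurd ⟨h1, h2⟩ hA
  have ev2 : ∀ᶠ ε in nhdsWithin (0 : ℝ) (Set.Ioi 0), ε < x f :=
    nhdsWithin_le_nhds (eventually_lt_nhds hf)
  have ev0 : ∀ᶠ ε in nhdsWithin (0 : ℝ) (Set.Ioi 0), 0 < ε := self_mem_nhdsWithin
  have t1 : Filter.Tendsto (fun ε => h e (x e + ε)) (nhdsWithin (0 : ℝ) (Set.Ioi 0))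
      (nhds (h e (x e))) := by
    refine (hcont e (x e) hxe).tendsto.comp (tendsto_nhdsWithin_iff.2 ⟨?_, ?_⟩)
    · have : Filter.Tendsto (fun ε : ℝ => x e + ε) (nhds 0) (nhds (x e + 0)) :=
        (continuous_const.add continuous_id).tendsto 0
      rw [add_zero] at this
      exact this.mono_left nhdsWithin_le_nhds
    · filter_upwards [ev0] with ε hε
      show 0 ≤ x e + ε
      linarith
  have t2 : Filter.Tendsto (fun ε => h f (x f - ε)) (nhdsWithin (0 : ℝ) (Set.Ioi 0))
      (nhds (h f (x f))) := by
    refine (hcont f (x f) hf.le).tendsto.comp (tendsto_nhdsWithin_iff.2 ⟨?_, ?_⟩)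
    · have : Filter.Tendsto (fun ε : ℝ => x f - ε) (nhds 0) (nhds (x f - 0)) :=
        (continuous_const.sub continuous_id).tendsto 0
      rw [sub_zero] at this
      exact this.mono_left nhdsWithin_le_nhds
    · filter_upwards [ev2] with ε hε
      show 0 ≤ x f - ε
      linarith
  obtain ⟨ε, ⟨⟨h0, h1⟩, h2⟩, h3⟩ := (((ev0.and ev1).and ev2).and (t1.eventually_lt t2 hlt)).exists
  set z : Fin n → ℝ := fun i => x i + (if i = e then ε else 0) - (if i = f then ε else 0) with hz
  have hze : z e = x e + ε := by simp [hz, hef]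
  have hzf : z f = x f - ε := by simp [hz, hef.symm]
  have hzo : ∀ i, i ≠ e → i ≠ f → z i = x i := by intro i h1 h2; simp [hz, h1, h2]
  have hsum : ∀ A : Finset (Fin n), ∑ i ∈ A, z i =
      ∑ i ∈ A, x i + (if e ∈ A then ε else 0) - (if f ∈ A then ε else 0) := by
    intro A
    simp [hz, Finset.sum_add_distrib, Finset.sum_sub_distrib]
  have hzB : z ∈ polyBase g := by
    refine ⟨⟨?_, ?_⟩, ?_⟩
    · intro i
      by_cases hi : i = e
      · subst hi; rw [hze]; linarith
      by_cases hi' : i = f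
      · subst hi'; rw [hzf]; linarith
      rw [hzo i hi hi']; exact hx.1.1 i
    · intro A
      rw [hsum]
      have := hx.1.2 A
      by_cases ha : e ∈ A <;> by_cases hb : f ∈ A <;> simp only [ha, hb, if_true, if_false]
      · linarith
      · have := h1 A ha hb; linarith
      · linarith
      · linarith
    · rw [hsum]; simp [hx.2]
  have hobj : ∑ i, w i (z i) - ∑ i, w i (x i) =
      (w e (x e + ε) - w e (x e)) + (w f (x f - ε) - w f (x f)) := by
    rw [← Finset.sum_sub_distrib]
    have : ∀ i ∈ Finset.univ, w i (z i) - w i (x i) =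
        (if i = e then (w e (x e + ε) - w e (x e)) else 0) +
        (if i = f then (w f (x f - ε) - w f (x f)) else 0) := by
      intro i _
      by_cases hi : i = e
      · subst hi; simp [hze, hef]
      by_cases hi' : i = f
      · subst hi'; simp [hzf, hi]
      simp [hzo i hi hi', hi, hi']
    rw [Finset.sum_congr rfl this, Finset.sum_add_distrib]
    simp
  have hm := hmin z hzB
  have s1 := (hconv e).convexOn.slope_le_of_hasDerivWithinAt (x := x e) (y := x e + ε)
    hxe (show (0:ℝ) ≤ x e + ε by linarith) (by linarith)
    (hderiv e (x e + ε) (show (0:ℝ) ≤ x e + ε by linarith))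
  have s2 := (hconv f).convexOn.le_slope_of_hasDerivWithinAt (x := x f - ε) (y := x f)
    (show (0:ℝ) ≤ x f - ε by linarith) hf.le (by linarith)
    (hderiv f (x f - ε) (show (0:ℝ) ≤ x f - ε by linarith))
  rw [slope_def_field] at s1 s2
  have e1 : x e + ε - x e = ε := by ring
  have e2 : x f - (x f - ε) = ε := by ring
  rw [e1] at s1
  rw [e2] at s2
  have s3 := lt_of_le_of_lt s1 (lt_of_lt_of_le h3 s2)
  rw [div_lt_div_iff_of_pos_right h0] at s3
  linarith

/-- Level sets of a minimizer dominate. -/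
theorem pm_level {n : ℕ} {g : Finset (Fin n) → ℝ} (hg : IsRankFunction g)
    {h : Fin n → ℝ → ℝ} {x : Fin n → ℝ} (hx : x ∈ polyBase g)
    (hex : ∀ e f : Fin n, 0 < x f → h e (x e) < h f (x f) →
      ∃ A : Finset (Fin n), e ∈ A ∧ f ∉ A ∧ PMTight g x A)
    (y : Fin n → ℝ) (hy : y ∈ polyBase g) (t : ℝ) :
    ∑ e ∈ Finset.univ.filter (fun e => h e (x e) ≤ t), y e ≤
      ∑ e ∈ Finset.univ.filter (fun e => h e (x e) ≤ t), x e := by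
  classical
  set L := Finset.univ.filter (fun e => h e (x e) ≤ t) with hL
  set H := Finset.univ.filter (fun f => t < h f (x f) ∧ 0 < x f) with hH
  have hex' : ∀ e f : Fin n, ∃ A : Finset (Fin n), PMTight g x A ∧
      (e ∈ L → f ∈ H → e ∈ A ∧ f ∉ A) := by
    intro e f
    by_cases hc : e ∈ L ∧ f ∈ H
    · have h1 : h e (x e) ≤ t := by simpa [hL] using hc.1
      have h2 : t < h f (x f) ∧ 0 < x f := by simpa [hH] using hc.2
      obtain ⟨A, ha, hb, hT⟩ := hex e f h2.2 (lt_of_le_of_lt h1 h2.1)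
      exact ⟨A, hT, fun _ _ => ⟨ha, hb⟩⟩
    · exact ⟨Finset.univ, hx.2, fun a b => absurd ⟨a, b⟩ hc⟩
  choose A hT hA using hex'
  set U : Finset (Fin n) := L.sup fun e => H.inf fun f => A e f with hU
  have hUT : PMTight g x U := by
    refine Finset.sup_induction (p := PMTight g x) ?_ ?_ ?_
    · show ∑ e ∈ (∅ : Finset (Fin n)), x e = g ∅
      simp [hg.1]
    · intro a ha b hb
      exact (pm_tight_union_inter hg hx ha hb).1
    · intro e _
      refine Finset.inf_induction (p := PMTight g x) ?_ ?_ ?_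
      · exact hx.2
      · intro a ha b hb
        exact (pm_tight_union_inter hg hx ha hb).2
      · intro f _
        exact hT e f
  have hLU : L ⊆ U := by
    intro e he
    have h1 : (H.inf fun f => A e f) ≤ U := Finset.le_sup (f := fun e => H.inf fun f => A e f) he
    apply h1
    have h2 : ({e} : Finset (Fin n)) ≤ H.inf fun f => A e f := by
      refine Finset.le_inf fun f hf => ?_
      exact Finset.singleton_subset_iff.2 (hA e f he hf).1
    exact h2 (Finset.mem_singleton_self e)
  have hUz : ∀ f ∈ U, f ∉ L → x f = 0 := by
    intro f hfU hfL
    by_contra hne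
    have hpos : 0 < x f := lt_of_le_of_ne (hx.1.1 f) (Ne.symm hne)
    have hfH : f ∈ H := by
      simp only [hL, Finset.mem_filter, Finset.mem_univ, true_and, not_le] at hfL
      simp [hH, hfL, hpos]
    have h1 : U ≤ Finset.univ.erase f := by
      refine Finset.sup_le fun e he => ?_
      refine (Finset.inf_le hfH).trans ?_
      intro i hi
      refine Finset.mem_erase.2 ⟨?_, Finset.mem_univ _⟩
      rintro rfl
      exact (hA e i he hfH).2 hi
    exact absurd (h1 hfU) (by simp)
  calc ∑ e ∈ L, y e ≤ ∑ e ∈ U, y e :=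
        Finset.sum_le_sum_of_subset_of_nonneg hLU fun i _ _ => hy.1.1 i
    _ ≤ g U := hy.1.2 U
    _ = ∑ e ∈ U, x e := hUT.symm
    _ = ∑ e ∈ L, x e := (Finset.sum_subset hLU hUz).symm

theorem pm_sorted_le {n : ℕ} (c : Fin n → ℝ) (i : Fin n) (s : ℝ) :
    sortedTuple c i ≤ s ↔ (i : ℕ) < (Finset.univ.filter (fun e => c e ≤ s)).card := by
  rw [← Tuple.lt_card_le_iff_apply_le_of_monotone (f := sortedTuple c) (Tuple.monotone_sort c)]
  have : (Finset.univ.filter (fun e => sortedTuple c e ≤ s)).card =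
      (Finset.univ.filter (fun e => c e ≤ s)).card := by
    refine Finset.card_equiv (Tuple.sort c) ?_
    intro i
    simp only [Finset.mem_filter, Finset.mem_univ, true_and]
    exact Iff.rfl
  rw [this]

/-- Domination of level sets gives strict lexicographic superiority. -/
theorem pm_strict {n : ℕ} {h : Fin n → ℝ → ℝ}
    (hmono : ∀ e, StrictMonoOn (h e) (Set.Ici 0)) {x y : Fin n → ℝ}
    (hx : ∀ e, 0 ≤ x e) (hy : ∀ e, 0 ≤ y e) (hne : y ≠ x)
    (hlev : ∀ t : ℝ, ∑ e ∈ Finset.univ.filter (fun e => h e (x e) ≤ t), y e ≤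
      ∑ e ∈ Finset.univ.filter (fun e => h e (x e) ≤ t), x e) :
    ∃ j : Fin n, (∀ i < j, sortedTuple (fun e => h e (x e)) i =
      sortedTuple (fun e => h e (y e)) i) ∧
      sortedTuple (fun e => h e (y e)) j < sortedTuple (fun e => h e (x e)) j := by
  classical
  have hinj : ∀ e, h e (x e) = h e (y e) → x e = y e := fun e he =>
    (hmono e).injOn (hx e) (hy e) he
  have hle : ∀ e, h e (x e) ≤ h e (y e) → x e ≤ y e := fun e he =>
    ((hmono e).le_iff_le (hx e) (hy e)).1 he
  obtain ⟨e1, he1⟩ := Function.ne_iff.1 hne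
  set D := Finset.univ.filter (fun e => x e ≠ y e) with hD
  obtain ⟨e0, he0, hmin⟩ := D.exists_min_image (fun e => min (h e (x e)) (h e (y e)))
    ⟨e1, by simp [hD, Ne.symm he1]⟩
  have he0' : x e0 ≠ y e0 := by simpa [hD] using he0
  set t := min (h e0 (x e0)) (h e0 (y e0)) with ht
  have hge : ∀ e, x e ≠ y e → t ≤ h e (x e) ∧ t ≤ h e (y e) := by
    intro e he
    exact le_min_iff.1 (hmin e (by simp [hD, he]))
  have hlow : ∀ e, h e (x e) ≤ t → x e ≤ y e := by
    intro e he
    by_cases hc : x e = y e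
    · exact hc.le
    · exact hle e (he.trans (hge e hc).2)
  have heq : ∀ e, h e (x e) ≤ t → x e = y e := by
    intro e he
    have h1 := (Finset.sum_eq_sum_iff_of_le (s := Finset.univ.filter (fun e => h e (x e) ≤ t))
      (f := x) (g := y) (fun i hi => hlow i (by simpa using hi))).1
      (le_antisymm (Finset.sum_le_sum fun i hi => hlow i (by simpa using hi)) (hlev t))
    exact h1 e (by simpa using he)
  have hx0 : t < h e0 (x e0) := by
    by_contra hc
    exact he0' (heq e0 (not_lt.1 hc))
  have hy0 : h e0 (y e0) ≤ t := by
    rcases min_choice (h e0 (x e0)) (h e0 (y e0)) with hc | hc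
    · exact absurd (ht.trans hc) hx0.ne
    · exact (ht.trans hc).ge
  set k := (Finset.univ.filter (fun e => h e (x e) ≤ t)).card with hk
  have hkl : k < (Finset.univ.filter (fun e => h e (y e) ≤ t)).card := by
    apply Finset.card_lt_card
    rw [Finset.ssubset_iff_of_subset]
    · exact ⟨e0, by simpa using hy0, by simpa using hx0⟩
    · intro e he
      simp only [Finset.mem_filter, Finset.mem_univ, true_and] at he ⊢
      rw [← heq e he]; exact he
  have hkn : k < n := hkl.trans_le ((Finset.card_le_univ _).trans (by simp))
  have hset : ∀ s < t, (Finset.univ.filter (fun e => h e (x e) ≤ s)) =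
      (Finset.univ.filter (fun e => h e (y e) ≤ s)) := by
    intro s hs
    ext e
    simp only [Finset.mem_filter, Finset.mem_univ, true_and]
    by_cases hc : x e = y e
    · rw [hc]
    · have := hge e hc
      constructor <;> intro _ <;> linarith
  have hiff : ∀ (i : Fin n) (s : ℝ), s < t → (sortedTuple (fun e => h e (x e)) i ≤ s ↔
      sortedTuple (fun e => h e (y e)) i ≤ s) := by
    intro i s hs
    rw [pm_sorted_le, pm_sorted_le, hset s hs]
  refine ⟨⟨k, hkn⟩, ?_, ?_⟩
  · intro i hi
    have hi' : (i : ℕ) < k := hi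
    have a1 : sortedTuple (fun e => h e (x e)) i ≤ t := (pm_sorted_le _ _ _).2 hi'
    have a2 : sortedTuple (fun e => h e (y e)) i ≤ t := (pm_sorted_le _ _ _).2 (hi'.trans hkl)
    apply le_antisymm
    · by_contra! hc
      exact absurd ((hiff i _ (hc.trans_le a1)).2 le_rfl) (not_le.2 hc)
    · by_contra! hc
      exact absurd ((hiff i _ (hc.trans_le a2)).1 le_rfl) (not_le.2 hc)
  · have a1 : sortedTuple (fun e => h e (y e)) ⟨k, hkn⟩ ≤ t := (pm_sorted_le _ _ _).2 hkl
    have a2 : ¬ sortedTuple (fun e => h e (x e)) ⟨k, hkn⟩ ≤ t := by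
      rw [pm_sorted_le]; exact lt_irrefl _
    exact a1.trans_lt (not_le.1 a2)

theorem pm_compact {n : ℕ} (g : Finset (Fin n) → ℝ) : IsCompact (polyBase g) := by
  have hsub : polyBase g ⊆ Set.Icc (fun _ => 0) (fun e => g {e}) := by
    intro x hx
    refine ⟨fun e => hx.1.1 e, fun e => ?_⟩
    simpa using hx.1.2 {e}
  refine isCompact_Icc.of_isClosed_subset ?_ hsub
  have : polyBase g = ((⋂ e, {x : Fin n → ℝ | 0 ≤ x e}) ∩
      (⋂ A : Finset (Fin n), {x : Fin n → ℝ | ∑ e ∈ A, x e ≤ g A})) ∩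
      {x : Fin n → ℝ | ∑ e, x e = g Finset.univ} := by
    ext x
    simp [polyBase, polyP]
  rw [this]
  refine IsClosed.inter (IsClosed.inter ?_ ?_) ?_
  · exact isClosed_iInter fun e => isClosed_le (by fun_prop) (by fun_prop)
  · exact isClosed_iInter fun A => isClosed_le (by fun_prop) (by fun_prop)
  · exact isClosed_eq (by fun_prop) (by fun_prop)

/-- Fujishige's characterization: for strictly convex continuously differentiable
`w_e` with derivatives `h_e`, a base `x ∈ B(g)` minimizes `∑_e w_e(y(e))` over `B(g)`
if and only if `x` is an `h`-lexicographically optimal base. -/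
theorem base_isOptimal_iff_lexOptimal (n : ℕ) (g : Finset (Fin n) → ℝ)
    (hg : IsRankFunction g) (w h : Fin n → ℝ → ℝ)
    (hconv : ∀ e, StrictConvexOn ℝ (Set.Ici 0) (w e))
    (hderiv : ∀ e, ∀ t ∈ Set.Ici (0 : ℝ), HasDerivWithinAt (w e) (h e t) (Set.Ici 0) t)
    (hcont : ∀ e, ContinuousOn (h e) (Set.Ici 0))
    (hmono : ∀ e, StrictMonoOn (h e) (Set.Ici 0))
    (x : Fin n → ℝ) (hx : x ∈ polyBase g) :
    (∀ y ∈ polyBase g, ∑ e, w e (x e) ≤ ∑ e, w e (y e)) ↔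
      IsLexOptimalBase g h x := by
  have key : ∀ z ∈ polyBase g, (∀ y ∈ polyBase g, ∑ e, w e (z e) ≤ ∑ e, w e (y e)) →
      ∀ y ∈ polyBase g, y ≠ z →
      ∃ j : Fin n, (∀ i < j, sortedTuple (fun e => h e (z e)) i =
        sortedTuple (fun e => h e (y e)) i) ∧
        sortedTuple (fun e => h e (y e)) j < sortedTuple (fun e => h e (z e)) j := by
    intro z hz hmin y hy hne
    exact pm_strict hmono hz.1.1 hy.1.1 hne
      (pm_level hg hz (pm_exchange hconv hderiv hcont hz hmin) y hy)
  constructor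
  · intro hmin
    refine ⟨hx, fun y hy => ?_⟩
    by_cases hne : y = x
    · subst hne; exact Or.inl rfl
    · exact Or.inr (key x hx hmin y hy hne)
  · intro hlex
    have hco : ContinuousOn (fun y : Fin n → ℝ => ∑ e, w e (y e)) (polyBase g) := by
      refine continuousOn_finsetSum _ fun e _ => ?_
      have h1 : ContinuousOn (w e) (Set.Ici 0) := fun t ht => (hderiv e t ht).continuousWithinAt
      exact h1.comp (continuous_apply e).continuousOn fun y hy => hy.1.1 e
    obtain ⟨z, hz, hzmin⟩ := (pm_compact g).exists_isMinOn ⟨x, hx⟩ hco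
    have hzm : ∀ y ∈ polyBase g, ∑ e, w e (z e) ≤ ∑ e, w e (y e) := fun y hy => hzmin hy
    by_cases hne : x = z
    · rw [hne]; exact hzm
    · exfalso
      obtain ⟨j, hj, hjl⟩ := key z hz hzm x hx hne
      rcases hlex.2 z hz with he | ⟨k, hk, hkl⟩
      · rw [he] at hjl; exact lt_irrefl _ hjl
      · rcases lt_trichotomy j k with hc | hc | hc
        · exact absurd (hk j hc) hjl.ne
        · subst hc; exact lt_asymm hjl hkl
        · exact absurd (hj k hc) hkl.ne
end

section
/- Let g be an integer-valued rank function on E = {1,…,n} and let w_e : ℝ_{≥0} → ℝ be convex for each e. Let x ∈ P(g) ∩ ℤ_{≥0}^n, let Ẽ := {j ∈ E : x + 𝟙_j ∈ P(g)} (where 𝟙_j is the j-th standard unit vector), and suppose k ∈ Ẽ attains the minimum of w_j(x(j)+1) − w_j(x(j)) over all j ∈ Ẽ. Then there exists an optimal solution x* of the integer problem minimizing Σ_{e=1}^n w_e(y(e)) over y ∈ B(g) ∩ ℤ^n such that x*(k) ≥ x(k). -/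
structure IntRank {n : ℕ} (G : Finset (Fin n) → ℤ) : Prop where
  empty : G ∅ = 0
  mono : ∀ A B : Finset (Fin n), A ⊆ B → G A ≤ G B
  submod : ∀ A B : Finset (Fin n), G (A ∪ B) + G (A ∩ B) ≤ G A + G B

def IntP {n : ℕ} (G : Finset (Fin n) → ℤ) (x : Fin n → ℤ) : Prop :=
  (∀ e, 0 ≤ x e) ∧ ∀ A : Finset (Fin n), ∑ e ∈ A, x e ≤ G A

lemma tight_union_inter {n : ℕ} {G : Finset (Fin n) → ℤ} (hG : IntRank G) {x : Fin n → ℤ}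
    (hx : IntP G x) {A B : Finset (Fin n)} (hA : ∑ e ∈ A, x e = G A) (hB : ∑ e ∈ B, x e = G B) :
    ∑ e ∈ A ∪ B, x e = G (A ∪ B) ∧ ∑ e ∈ A ∩ B, x e = G (A ∩ B) := by
  have h1 := Finset.sum_union_inter (s₁ := A) (s₂ := B) (f := x)
  have h2 := hG.submod A B
  have h3 := hx.2 (A ∪ B)
  have h4 := hx.2 (A ∩ B)
  constructor <;> linarith

lemma exists_max_tight {n : ℕ} {G : Finset (Fin n) → ℤ} (hG : IntRank G) {x : Fin n → ℤ}
    (hx : IntP G x) : ∃ D : Finset (Fin n), ∑ e ∈ D, x e = G D ∧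
      ∀ j, j ∉ D → ∀ A : Finset (Fin n), j ∈ A → ∑ e ∈ A, x e + 1 ≤ G A := by
  obtain ⟨D, hD, hmax⟩ := Set.exists_max_image {D : Finset (Fin n) | ∑ e ∈ D, x e = G D}
    Finset.card (Set.toFinite _) ⟨∅, by simp [hG.empty]⟩
  refine ⟨D, hD, fun j hj A hjA => ?_⟩
  by_contra hlt
  have hA : ∑ e ∈ A, x e = G A := by
    have := hx.2 A
    lia
  have hU := (tight_union_inter hG hx hD hA).1
  have h1 := hmax _ hU
  have h2 : D.card < (D ∪ A).card := Finset.card_lt_card <| by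
    refine ⟨Finset.subset_union_left, fun h => hj (h (Finset.mem_union_right _ hjA))⟩
  lia

lemma exists_min_tight {n : ℕ} {G : Finset (Fin n) → ℤ} (hG : IntRank G) {x : Fin n → ℤ}
    (hx : IntP G x) (hb : ∑ e, x e = G Finset.univ) (k : Fin n) :
    ∃ T : Finset (Fin n), k ∈ T ∧ ∑ e ∈ T, x e = G T ∧
      ∀ j ∈ T, j ≠ k → 1 ≤ x j ∧ 
        ∀ A : Finset (Fin n), k ∈ A → j ∉ A → ∑ e ∈ A, x e + 1 ≤ G A := by
  obtain ⟨T, hT, hmin⟩ := Set.exists_min_image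
    {D : Finset (Fin n) | k ∈ D ∧ ∑ e ∈ D, x e = G D}
    Finset.card (Set.toFinite _) ⟨Finset.univ, by simp [hb]⟩
  have key : ∀ j ∈ T, j ≠ k → 
        ∀ A : Finset (Fin n), k ∈ A → j ∉ A → ∑ e ∈ A, x e + 1 ≤ G A := by
    intro j hj hjk A hkA hjA
    by_contra hlt
    have hA : ∑ e ∈ A, x e = G A := by
      have := hx.2 A
      lia
    have hU := (tight_union_inter hG hx hT.2 hA).2
    have h1 := hmin (T ∩ A) ⟨Finset.mem_inter.2 ⟨hT.1, hkA⟩, hU⟩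
    have h2 : (T ∩ A).card < T.card := Finset.card_lt_card <| by
      refine ⟨Finset.inter_subset_left, fun h => hjA (Finset.mem_inter.1 (h hj)).2⟩
    lia
  refine ⟨T, hT.1, hT.2, fun j hj hjk => ⟨?_, key j hj hjk⟩⟩
  have h1 := key j hj hjk (T.erase j) (Finset.mem_erase.2 ⟨hjk.symm, hT.1⟩) (by simp)
  have h2 := Finset.add_sum_erase T x hj
  have h3 := hG.mono _ _ (Finset.erase_subset j T)
  have h4 := hT.2
  lia

lemma intP_finite {n : ℕ} (G : Finset (Fin n) → ℤ) : {x | IntP G x}.Finite := by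
  refine (Set.finite_Icc (0 : Fin n → ℤ) (fun e => G {e})).subset ?_
  intro x hx
  refine ⟨fun e => hx.1 e, fun e => ?_⟩
  simpa using hx.2 {e}

lemma sum_add_single {n : ℕ} (x : Fin n → ℤ) (j : Fin n) (c : ℤ) (A : Finset (Fin n)) :
    ∑ e ∈ A, (x + Pi.single j c : Fin n → ℤ) e = ∑ e ∈ A, x e + if j ∈ A then c else 0 := by
  simp [Finset.sum_add_distrib]

lemma intP_add {n : ℕ} {G : Finset (Fin n) → ℤ} {x : Fin n → ℤ}
    (hx : IntP G x) {j : Fin n} (h : ∀ A : Finset (Fin n), j ∈ A → ∑ e ∈ A, x e + 1 ≤ G A) :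
    IntP G (x + Pi.single j 1) := by
  constructor
  · intro e
    have h1 := hx.1 e
    have h2 : (0 : ℤ) ≤ (Pi.single j 1 : Fin n → ℤ) e := by
      by_cases he : e = j
      · subst he; simp
      · simp [he]
    simpa using add_nonneg h1 h2
  · intro A
    rw [sum_add_single]
    split_ifs with hj
    · exact h A hj
    · simpa using hx.2 A

lemma exists_base {n : ℕ} {G : Finset (Fin n) → ℤ} (hG : IntRank G) {x : Fin n → ℤ}
    (hx : IntP G x) : ∃ y, IntP G y ∧ ∑ e, y e = G Finset.univ := by
  obtain ⟨y, hy, hmax⟩ := Set.exists_max_image {x | IntP G x} (fun x => ∑ e, x e)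
    (intP_finite G) ⟨x, hx⟩
  obtain ⟨D, hD, hDm⟩ := exists_max_tight hG hy
  by_cases hU : D = Finset.univ
  · subst hU; exact ⟨y, hy, hD⟩
  · exfalso
    obtain ⟨j, hj⟩ : ∃ j, j ∉ D := by
      by_contra! h
      exact hU (Finset.eq_univ_iff_forall.2 h)
    have h1 := hmax _ (intP_add hy (hDm j hj))
    simp only [sum_add_single] at h1
    simp at h1

lemma convex_incr {f : ℝ → ℝ} (hf : ConvexOn ℝ (Set.Ici 0) f) {a b : ℝ} (ha : 0 ≤ a)
    (hab : a ≤ b) : f (a + 1) - f a ≤ f (b + 1) - f b := by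
  have hd : 0 < b + 1 - a := by linarith
  have hu : 1 / (b + 1 - a) + (b - a) / (b + 1 - a) = 1 := by field_simp; ring
  have ht : 0 ≤ 1 / (b + 1 - a) := by positivity
  have hs : 0 ≤ (b - a) / (b + 1 - a) := div_nonneg (by linarith) hd.le
  have ma : a ∈ Set.Ici (0:ℝ) := ha
  have mb : b + 1 ∈ Set.Ici (0:ℝ) := by simp; linarith
  have h1 := hf.2 ma mb hs ht (by linarith)
  have h2 := hf.2 ma mb ht hs hu
  have e1 : (b - a) / (b + 1 - a) * a + 1 / (b + 1 - a) * (b + 1) = a + 1 := by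
    field_simp; ring
  have e2 : 1 / (b + 1 - a) * a + (b - a) / (b + 1 - a) * (b + 1) = b := by
    field_simp; ring
  simp only [smul_eq_mul] at h1 h2
  rw [e1] at h1
  rw [e2] at h2
  generalize 1 / (b + 1 - a) = t at *
  have e3 : (b - a) / (b + 1 - a) = 1 - t := by linarith
  rw [e3] at h1 h2
  linarith

lemma int_main {n : ℕ} {G : Finset (Fin n) → ℤ} (hG : IntRank G)
    (w : Fin n → ℝ → ℝ) (hw : ∀ e, ConvexOn ℝ (Set.Ici 0) (w e))
    (x : Fin n → ℤ) (hx : IntP G x) (k : Fin n) (hk : IntP G (x + Pi.single k 1))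
    (hkmin : ∀ j : Fin n, IntP G (x + Pi.single j 1) →
      w k (x k + 1) - w k (x k) ≤ w j (x j + 1) - w j (x j)) :
    ∃ y, IntP G y ∧ ∑ e, y e = G Finset.univ ∧
      (∀ z, IntP G z → ∑ e, z e = G Finset.univ → ∑ e, w e (y e) ≤ ∑ e, w e (z e)) ∧
      x k ≤ y k := by
  obtain ⟨b0, hb0, hb0'⟩ := exists_base hG hx
  obtain ⟨b, ⟨hb, hb'⟩, hbmin⟩ := Set.exists_min_image
    {y | IntP G y ∧ ∑ e, y e = G Finset.univ} (fun y => ∑ e, w e (y e))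
    ((intP_finite G).subset fun y hy => hy.1) ⟨b0, hb0, hb0'⟩
  obtain ⟨y, ⟨⟨hy, hyb⟩, hyo⟩, hymax⟩ := Set.exists_max_image
    {y | (IntP G y ∧ ∑ e, y e = G Finset.univ) ∧ ∑ e, w e (y e) ≤ ∑ e, w e (b e)}
    (fun y => y k)
    ((intP_finite G).subset fun y hy => hy.1.1) ⟨b, ⟨hb, hb'⟩, le_refl _⟩
  refine ⟨y, hy, hyb, fun z hz hz' => hyo.trans (hbmin z ⟨hz, hz'⟩), ?_⟩
  by_contra! hlt
  obtain ⟨D, hD, hDm⟩ := exists_max_tight hG hx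
  obtain ⟨T, hkT, hT, hTm⟩ := exists_min_tight hG hy hyb k
  have hj : ∃ j ∈ T \ D, x j < y j := by
    have h1 := hG.submod T D
    have h2 := hk.2 (T ∪ D)
    rw [sum_add_single, if_pos (Finset.mem_union_left _ hkT)] at h2
    have h3 := hy.2 (T ∩ D)
    have h4 := Finset.sum_inter_add_sum_sdiff T D y
    have h5 := Finset.sum_sdiff (f := x) (Finset.subset_union_right (s₁ := T) (s₂ := D))
    rw [Finset.union_sdiff_right] at h5
    exact Finset.exists_lt_of_sum_lt (by lia)
  obtain ⟨j, hj, hjlt⟩ := hj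
  obtain ⟨hjT, hjD⟩ := Finset.mem_sdiff.1 hj
  have hjk : j ≠ k := by rintro rfl; lia
  obtain ⟨hj1, hjA⟩ := hTm j hjT hjk
  have m1 := hkmin j (intP_add hx (hDm j hjD))
  have m2 := convex_incr (hw k) (a := (y k : ℝ)) (b := (x k : ℝ))
    (by exact_mod_cast hy.1 k) (by exact_mod_cast hlt.le)
  have m3 := convex_incr (hw j) (a := (x j : ℝ)) (b := (y j : ℝ) - 1)
    (by exact_mod_cast hx.1 j) (by
      have : x j ≤ y j - 1 := by lia
      exact_mod_cast this)
  rw [sub_add_cancel] at m3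
  let z : Fin n → ℤ := y + Pi.single k 1 + Pi.single j (-1)
  have zk : z k = y k + 1 := by simp [z, hjk.symm]
  have zj : z j = y j - 1 := by simp [z, hjk]; ring
  have zo : ∀ e, e ≠ k → e ≠ j → z e = y e := by
    intro e h1 h2
    simp [z, h1, h2]
  have zsum : ∀ A : Finset (Fin n), ∑ e ∈ A, z e =
      ∑ e ∈ A, y e + (if k ∈ A then 1 else 0) + (if j ∈ A then -1 else 0) := by
    intro A
    simp only [z, sum_add_single]
  have hzP : IntP G z := by
    constructor
    · intro e
      have := hy.1 e
      by_cases h1 : e = k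
      · subst h1; lia
      by_cases h2 : e = j
      · subst h2; lia
      rw [zo e h1 h2]; exact this
    · intro A
      have h1 := hy.2 A
      have h2 := hjA A
      rw [zsum]
      split_ifs <;> grind
  have hzB : ∑ e, z e = G Finset.univ := by
    rw [zsum]; simp [hyb]
  have hcost : ∑ e, (w e (z e) - w e (y e)) =
      (w k (z k) - w k (y k)) + (w j (z j) - w j (y j)) := by
    refine Finset.sum_eq_add k j hjk.symm ?_ (by simp) (by simp)
    rintro e - ⟨h1, h2⟩
    rw [zo e h1 h2, sub_self]
  rw [Finset.sum_sub_distrib, zk, zj] at hcost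
  push_cast at hcost
  have h := hymax z ⟨⟨hzP, hzB⟩, by linarith⟩
  simp only [zk] at h
  lia

lemma mem_polyP_iff {n : ℕ} {g : Finset (Fin n) → ℝ} {G : Finset (Fin n) → ℤ}
    (h : ∀ A, g A = G A) (x : Fin n → ℤ) : (fun e => (x e : ℝ)) ∈ polyP g ↔ IntP G x := by
  simp only [polyP, IntP, Set.mem_ofPred_eq, h]
  norm_cast

lemma cast_add_single {n : ℕ} (x : Fin n → ℤ) (j : Fin n) :
    (fun e => (x e : ℝ)) + Pi.single j 1 =
      fun e => (((x + Pi.single j 1 : Fin n → ℤ) e : ℤ) : ℝ) := by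
  ext e
  by_cases he : e = j
  · subst he; simp
  · simp [he]

/-- Greedy monotonicity (Gil et al.): if `x ∈ P(g) ∩ ℤ_{≥0}ⁿ` and `k` minimizes the
marginal cost `w_j(x(j)+1) − w_j(x(j))` among all `j` with `x + 𝟙_j ∈ P(g)`, then some
optimal solution `x*` of the integer problem over `B(g) ∩ ℤⁿ` satisfies `x*(k) ≥ x(k)`. -/
theorem greedy_increment_in_optimal (n : ℕ) (g : Finset (Fin n) → ℝ)
    (hg : IsRankFunction g) (hgint : ∀ A, ∃ z : ℤ, g A = z)
    (w : Fin n → ℝ → ℝ) (hw : ∀ e, ConvexOn ℝ (Set.Ici 0) (w e))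
    (x : Fin n → ℝ) (hx : x ∈ polyP g) (hxint : ∀ e, ∃ z : ℤ, x e = z)
    (k : Fin n) (hk : x + Pi.single k 1 ∈ polyP g)
    (hkmin : ∀ j : Fin n, x + Pi.single j 1 ∈ polyP g →
      w k (x k + 1) - w k (x k) ≤ w j (x j + 1) - w j (x j)) :
    ∃ xstar ∈ polyBase g, (∀ e, ∃ z : ℤ, xstar e = z) ∧
      (∀ y ∈ polyBase g, (∀ e, ∃ z : ℤ, y e = z) →
        ∑ e, w e (xstar e) ≤ ∑ e, w e (y e)) ∧
      x k ≤ xstar k := by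
  choose G hGg using hgint
  choose X hX using hxint
  obtain rfl : x = fun e => (X e : ℝ) := funext hX
  have hG : IntRank G := by
    obtain ⟨h1, -, h3, h4⟩ := hg
    simp only [hGg] at h1 h3 h4
    exact ⟨by exact_mod_cast h1, fun A B h => by exact_mod_cast h3 A B h,
      fun A B => by exact_mod_cast h4 A B⟩
  simp only [cast_add_single, mem_polyP_iff hGg] at hx hk hkmin
  obtain ⟨y, hy, hyb, hyo, hyk⟩ := int_main hG w hw X hx k hk hkmin
  refine ⟨fun e => (y e : ℝ), ⟨(mem_polyP_iff hGg y).2 hy, ?_⟩, fun e => ⟨y e, rfl⟩, ?_, ?_⟩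
  · rw [hGg]; beta_reduce; exact_mod_cast hyb
  · rintro z ⟨hz, hzb⟩ hzint
    choose Z hZ using hzint
    obtain rfl : z = fun e => (Z e : ℝ) := funext hZ
    refine hyo Z ((mem_polyP_iff hGg Z).1 hz) ?_
    rw [hGg] at hzb
    beta_reduce at hzb
    exact_mod_cast hzb
  · beta_reduce; exact_mod_cast hyk
end
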